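/- Let X_n = O((ξ_n,q_n)) be a sequence of T-periodic orbits with repetitive pattern, let A_n be the sets defined below, and define ρ_1 = 1/(1+λ_1) and ρ_{n+1} = ρ_n/(1+λ_{n+1}). Then for every n ≥ 1 the proportion of the orbit X_n whose fiber coordinate belongs to A_n is at least ρ_n: #{ℓ ∈ {1,…,π_n} : f_{ω^n_ℓ}∘⋯∘f_{ω^n_1}(q_n) ∈ A_n} / π_n ≥ ρ_n. -/

import Mathlib

open MeasureTheory Filter Set
open scoped ENNReal NNReal

noncomputable section

/-- The two-sided full shift space on `k` symbols. -/
abbrev Shift (k : ℕ) := ℤ → Fin k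

/-- The shift map `σ`. -/
def shiftMap (k : ℕ) : Shift k → Shift k := fun ξ i => ξ (i + 1)

/-- The circle `S¹`, modelled as `ℝ/ℤ`. -/
abbrev Circle1 := AddCircle (1 : ℝ)

/-- The phase space `M = Σ_k × S¹`. -/
abbrev SkewM (k : ℕ) := Shift k × Circle1

/-- Canonical projection `ℝ → S¹`. -/
def projCircle : ℝ → Circle1 := fun x => (x : Circle1)

/-- A locally constant skew product system over the full shift with circle fibers:
the fiber maps `f j` are `C¹` diffeomorphisms of the circle, recorded together with
lifts `F j : ℝ → ℝ`. -/
structure SkewSetup (k : ℕ) where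
  f : Fin k → Circle1 → Circle1
  F : Fin k → ℝ → ℝ
  compat : ∀ j (x : ℝ), f j (projCircle x) = projCircle (F j x)
  F_equiv : ∀ j x, F j (x + 1) = F j x + 1
  F_smooth : ∀ j, ContDiff ℝ 1 (F j)
  F_bij : ∀ j, Function.Bijective (F j)
  Finv_smooth : ∀ j, ContDiff ℝ 1 (Function.invFun (F j))

/-- The skew product map `T(ξ,x) = (σξ, f_{ξ₀} x)`. -/
def SkewSetup.T {k : ℕ} (S : SkewSetup k) : SkewM k → SkewM k :=
  fun z => (shiftMap k z.1, S.f (z.1 0) z.2)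

/-- The composition `f_{w (m-1)} ∘ ⋯ ∘ f_{w 0}` of the fiber maps along a word `w`. -/
def SkewSetup.wordComp {k : ℕ} (S : SkewSetup k) (w : ℕ → Fin k) : ℕ → Circle1 → Circle1
  | 0 => id
  | m + 1 => S.f (w m) ∘ S.wordComp w m

/-- The corresponding composition of the lifts. -/
def SkewSetup.wordCompLift {k : ℕ} (S : SkewSetup k) (w : ℕ → Fin k) : ℕ → ℝ → ℝ
  | 0 => id
  | m + 1 => S.F (w m) ∘ S.wordCompLift w m

/-- A sequence of `T`-periodic orbits with repetitive pattern (Definition 2.2 of the paper).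
The `n`-th periodic point is `(ξ n, q n)` where `ξ n` is the infinite repetition of the
word `w n 0, …, w n (π n - 1)`; the intervals `J n ⊆ S¹` are the arcs
`projCircle '' Icc (a n) (b n)`. -/
structure RepetitivePattern {k : ℕ} (S : SkewSetup k) where
  /-- the periods -/
  π : ℕ → ℕ
  π_pos : ∀ n, 0 < π n
  /-- the words (`w n i` is the letter `ω^n_{i+1}` of the paper) -/
  w : ℕ → ℕ → Fin k
  /-- the fiber coordinates of the periodic points -/
  q : ℕ → Circle1
  /-- endpoints of (lifts of) the intervals `J n` -/
  a : ℕ → ℝ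
  b : ℕ → ℝ
  a_lt_b : ∀ n, a n < b n
  nested : ∀ n, Icc (a (n + 1)) (b (n + 1)) ⊆ Icc (a n) (b n)
  len_lt : ∀ n, b (n + 1) - a (n + 1) < b n - a n
  len_to_zero : Tendsto (fun n => b n - a n) atTop (nhds 0)
  q_mem : ∀ n, q n ∈ projCircle '' Icc (a n) (b n)
  /-- `J 0, f_{ω^0_1}(J 0), …, f_{ω^0_{π 0 - 1}}∘⋯∘f_{ω^0_1}(J 0)` are pairwise disjoint -/
  disjoint0 : ∀ ℓ₁ ℓ₂, ℓ₁ < ℓ₂ → ℓ₂ < π 0 →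
    Disjoint (S.wordComp (w 0) ℓ₁ '' (projCircle '' Icc (a 0) (b 0)))
             (S.wordComp (w 0) ℓ₂ '' (projCircle '' Icc (a 0) (b 0)))
  /-- `q n` is fixed by `g n = f_{ω^n_{π n}} ∘ ⋯ ∘ f_{ω^n_1}` -/
  fixed : ∀ n, S.wordComp (w n) (π n) (q n) = q n
  /-- `|g_n'| < 1` on `J n` -/
  contracting : ∀ n, ∀ x ∈ Icc (a n) (b n), |deriv (S.wordCompLift (w n) (π n)) x| < 1
  /-- the numbers `k_n` (for `n ≥ 1`) -/
  kseq : ℕ → ℕ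
  /-- the numbers `R_n` (for `n ≥ 1`) -/
  Rseq : ℕ → ℕ
  kseq_ge : ∀ n, 2 ≤ kseq (n + 1)
  Rseq_ge : ∀ n, 1 ≤ Rseq (n + 1)
  /-- `g (n+1) = T_{R (n+1)} ∘ (g n)^{k (n+1)}`, encoded on the level of words:
  the word of `ξ (n+1)` is `k (n+1)` repetitions of the word of `ξ n` followed by a
  word of length `R (n+1)` -/
  period_eq : ∀ n, π (n + 1) = kseq (n + 1) * π n + Rseq (n + 1)
  word_eq : ∀ n, ∀ i < kseq (n + 1) * π n, w (n + 1) i = w n (i % π n)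
  /-- the sequence `λ_n = R_n / (k_n π_{n-1})` is summable -/
  lam_summable : Summable fun n => (Rseq (n + 1) : ℝ) / (kseq (n + 1) * π n)

namespace RepetitivePattern

variable {k : ℕ} {S : SkewSetup k}

/-- The `σ`-periodic point `ξ n`, the infinite repetition of the `n`-th word. -/
def ξp (P : RepetitivePattern S) (n : ℕ) : Shift k :=
  fun i => P.w n (Int.toNat (i % (P.π n : ℤ)))

/-- The measure `μ_{X_n}`, uniformly distributed on the `n`-th periodic orbit. -/
def μX (P : RepetitivePattern S) (n : ℕ) : Measure (SkewM k) :=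
  (P.π n : ℝ≥0∞)⁻¹ • ∑ ℓ ∈ Finset.range (P.π n), Measure.dirac (S.T^[ℓ] (P.ξp n, P.q n))

/-- The projected measure `ν_n`, uniformly distributed on the `σ`-orbit of `ξ n`. -/
def νX (P : RepetitivePattern S) (n : ℕ) : Measure (Shift k) :=
  (P.π n : ℝ≥0∞)⁻¹ • ∑ ℓ ∈ Finset.range (P.π n), Measure.dirac ((shiftMap k)^[ℓ] (P.ξp n))

end RepetitivePattern

/-- Weak-star convergence of a sequence of measures. -/
def WeakStarTendsto {X : Type*} [TopologicalSpace X] [MeasurableSpace X]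
    (μs : ℕ → Measure X) (μ : Measure X) : Prop :=
  ∀ g : C(X, ℝ), Tendsto (fun n => ∫ x, g x ∂(μs n)) atTop (nhds (∫ x, g x ∂μ))

/-- A probability measure on `M` has periodic repetitive pattern if it is the weak-star
limit of the measures `μ_{X_n}` for some sequence of periodic orbits with repetitive
pattern. -/
def HasPeriodicRepetitivePattern {k : ℕ} (S : SkewSetup k) (μ : Measure (SkewM k)) : Prop :=
  ∃ P : RepetitivePattern S, WeakStarTendsto (fun n => P.μX n) μ

/-- The Kolmogorov–Sinai (measure-theoretic) entropy of `T` with respect to `μ`: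
the supremum, over all finite measurable colorings `c : X → Fin m`, of the entropy of the
associated process, the latter being computed (via subadditivity) as the infimum of
`H_n/n` where `H_n` is the Shannon entropy of the partition of `X` according to the
itinerary `(c x, c (T x), …, c (T^{n-1} x))`. -/
def ksEntropy {X : Type*} [MeasurableSpace X] (T : X → X) (μ : Measure X) : ℝ≥0∞ :=
  ⨆ (m : ℕ) (c : {c : X → Fin m // Measurable c}),
    ⨅ n : ℕ, ENNReal.ofReal
      ((∑ s : Fin (n + 1) → Fin m,
        Real.negMulLog ((μ {x | ∀ i : Fin (n + 1), c.1 (T^[(i : ℕ)] x) = s i}).toReal))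
        / ((n : ℝ) + 1))


namespace RepetitivePattern

variable {k : ℕ} {S : SkewSetup k}

/-- The map `g n = f_{ω^n_{π n}} ∘ ⋯ ∘ f_{ω^n_1}`. -/
def g (P : RepetitivePattern S) (n : ℕ) : Circle1 → Circle1 :=
  S.wordComp (P.w n) (P.π n)

/-- The composition `g_0^{ℓ 1} ∘ g_1^{ℓ 2} ∘ ⋯ ∘ g_{n-1}^{ℓ n}`. -/
def multiComp (P : RepetitivePattern S) : ℕ → (ℕ → ℕ) → Circle1 → Circle1
  | 0, _ => id
  | n + 1, ℓ => P.multiComp n ℓ ∘ (P.g n)^[ℓ (n + 1)]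

/-- The set `I_n(J') = ⋃_{ℓ_n=0}^{k_n} ⋯ ⋃_{ℓ_1=0}^{k_1} g_0^{ℓ_1}∘⋯∘g_{n-1}^{ℓ_n}(J')`. -/
def Iset (P : RepetitivePattern S) (n : ℕ) (J' : Set Circle1) : Set Circle1 :=
  ⋃ (ℓ : ℕ → ℕ) (_ : ∀ i, 1 ≤ i → i ≤ n → ℓ i ≤ P.kseq i), P.multiComp n ℓ '' J'

/-- The set `A_n(J') = I_n(J') ∪ ⋃_{ℓ=1}^{π_0} f_{ω^0_ℓ}∘⋯∘f_{ω^0_1}(I_n(J'))`. -/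
def Aset (P : RepetitivePattern S) (n : ℕ) (J' : Set Circle1) : Set Circle1 :=
  P.Iset n J' ∪
    ⋃ (ℓ : ℕ) (_ : 1 ≤ ℓ) (_ : ℓ ≤ P.π 0), S.wordComp (P.w 0) ℓ '' P.Iset n J'

/-- `λ_n = R_n / (k_n π_{n-1})`. -/
def lam (P : RepetitivePattern S) (n : ℕ) : ℝ :=
  (P.Rseq n : ℝ) / ((P.kseq n : ℝ) * (P.π (n - 1) : ℝ))

end RepetitivePattern

namespace SkewSetup

variable {k : ℕ} (S : SkewSetup k)

theorem wordComp_congr {w w' : ℕ → Fin k} {m : ℕ} (h : ∀ i < m, w i = w' i) :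
    S.wordComp w m = S.wordComp w' m := by
  induction m with
  | zero => rfl
  | succ m ih =>
    rw [wordComp, wordComp, h m m.lt_succ_self, ih fun i hi => h i (hi.trans m.lt_succ_self)]

theorem wordComp_add (w : ℕ → Fin k) (m n : ℕ) :
    S.wordComp w (m + n) = S.wordComp (fun i => w (m + i)) n ∘ S.wordComp w m := by
  induction n with
  | zero => rfl
  | succ n ih => rw [← Nat.add_assoc, wordComp, wordComp, ih, Function.comp_assoc]

/-- If `w` starts with `s` copies of the first `p` letters of `v`, followed by the first `r` of
these letters, then its composition is the `s`-th iterate of that of `v` followed by `r` steps. -/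
theorem wordComp_of_repeats {w v : ℕ → Fin k} {p s r : ℕ} (hr : r ≤ p)
    (h : ∀ i < s * p + r, w i = v (i % p)) :
    S.wordComp w (s * p + r) = S.wordComp v r ∘ (S.wordComp v p)^[s] := by
  induction s generalizing r with
  | zero =>
    simp only [Nat.zero_mul, Nat.zero_add] at h ⊢
    refine S.wordComp_congr fun i hi => ?_
    rw [h i hi, Nat.mod_eq_of_lt (hi.trans_le hr)]
  | succ s ih =>
    have hs : S.wordComp w ((s + 1) * p) = (S.wordComp v p)^[s + 1] := by
      rw [Function.iterate_succ', Nat.succ_mul]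
      exact ih le_rfl fun i hi => h i (by rw [Nat.succ_mul]; omega)
    rw [wordComp_add, hs]
    congr 1
    refine S.wordComp_congr fun i hi => ?_
    rw [h _ (by omega), Nat.mul_add_mod', Nat.mod_eq_of_lt (hi.trans_le hr)]

end SkewSetup

namespace RepetitivePattern

variable {k : ℕ} {S : SkewSetup k} (P : RepetitivePattern S)

theorem multiComp_congr {n : ℕ} {ℓ ℓ' : ℕ → ℕ} (h : ∀ i, 1 ≤ i → i ≤ n → ℓ i = ℓ' i) :
    P.multiComp n ℓ = P.multiComp n ℓ' := by
  induction n with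
  | zero => rfl
  | succ n ih =>
    rw [multiComp, multiComp, h (n + 1) (by omega) le_rfl,
      ih fun i h₁ h₂ => h i h₁ (h₂.trans n.le_succ)]

/-- The times before `π n` at which the composition along the `n`-th word is of the form
`f_{ω^0_t} ∘ ⋯ ∘ f_{ω^0_1} ∘ g_0^{ℓ 1} ∘ ⋯ ∘ g_{n-1}^{ℓ n}` include a set of
`k_1 ⋯ k_n π_0` elements. -/
theorem exists_finset_wordComp_eq_multiComp (n : ℕ) :
    ∃ D : Finset ℕ, (D.card = (∏ i ∈ Finset.range n, P.kseq (i + 1)) * P.π 0) ∧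
      ∀ r ∈ D, r < P.π n ∧ ∃ ℓ : ℕ → ℕ, (∀ i, 1 ≤ i → i ≤ n → ℓ i ≤ P.kseq i) ∧
        ∃ t < P.π 0, S.wordComp (P.w n) r = S.wordComp (P.w 0) t ∘ P.multiComp n ℓ := by
  induction n with
  | zero =>
    refine ⟨Finset.range (P.π 0), by simp, fun r hr => ?_⟩
    rw [Finset.mem_range] at hr
    exact ⟨hr, 0, by intros; omega, r, hr, rfl⟩
  | succ n ih =>
    obtain ⟨D, hcard, hD⟩ := ih
    refine ⟨(Finset.range (P.kseq (n + 1)) ×ˢ D).image fun p => p.1 * P.π n + p.2, ?_, ?_⟩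
    · rw [Finset.card_image_of_injOn, Finset.card_product, hcard, Finset.card_range,
        Finset.prod_range_succ]
      · ring
      · rintro ⟨s, r⟩ h ⟨s', r'⟩ h' (heq : s * P.π n + r = s' * P.π n + r')
        simp only [Finset.coe_product, Set.mem_prod, Finset.mem_coe] at h h'
        have hr := (hD r h.2).1
        have hr' := (hD r' h'.2).1
        have hrr : r = r' := by
          have := congrArg (· % P.π n) heq
          simpa [Nat.mul_add_mod', Nat.mod_eq_of_lt hr, Nat.mod_eq_of_lt hr'] using this
        subst hrr
        have hss := Nat.eq_of_mul_eq_mul_right (P.π_pos n) (Nat.add_right_cancel heq)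
        rw [hss]
    · intro m hm
      obtain ⟨⟨s, r⟩, hsr, rfl⟩ := Finset.mem_image.1 hm
      rw [Finset.mem_product, Finset.mem_range] at hsr
      obtain ⟨hs, hr⟩ := hsr
      obtain ⟨hrπ, ℓ, hℓ, t, ht, heq⟩ := hD r hr
      dsimp only at hs ⊢
      have hlt : s * P.π n + r < P.kseq (n + 1) * P.π n := by
        have := Nat.mul_le_mul_right (P.π n) (Nat.succ_le_of_lt hs)
        rw [Nat.succ_mul] at this
        omega
      refine ⟨by rw [P.period_eq]; omega, Function.update ℓ (n + 1) s, fun i h₁ h₂ => ?_, t, ht, ?_⟩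
      · rcases eq_or_ne i (n + 1) with rfl | hi
        · simpa using hs.le
        · rw [Function.update_of_ne hi]
          exact hℓ i h₁ (by omega)
      · have hmulti : P.multiComp n (Function.update ℓ (n + 1) s) = P.multiComp n ℓ :=
          P.multiComp_congr fun i _ h₂ => Function.update_of_ne (by omega) _ _
        rw [S.wordComp_of_repeats hrπ.le fun i hi => P.word_eq n i (hi.trans hlt), heq, multiComp,
          hmulti, Function.update_self, Function.comp_assoc]
        rfl

theorem wordComp_multiComp_mem_Aset {n t : ℕ} {ℓ : ℕ → ℕ} {J : Set Circle1} {x : Circle1}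
    (hx : x ∈ J) (hℓ : ∀ i, 1 ≤ i → i ≤ n → ℓ i ≤ P.kseq i) (ht : t ≤ P.π 0) :
    S.wordComp (P.w 0) t (P.multiComp n ℓ x) ∈ P.Aset n J := by
  have hI : P.multiComp n ℓ x ∈ P.Iset n J :=
    mem_iUnion₂.2 ⟨ℓ, hℓ, mem_image_of_mem _ hx⟩
  rcases t.eq_zero_or_pos with rfl | h0
  · exact Or.inl hI
  · exact Or.inr (mem_iUnion.2 ⟨t, mem_iUnion₂.2 ⟨h0, ht, mem_image_of_mem _ hI⟩⟩)

theorem le_ncard_orbit_mem_Aset (n : ℕ) {J : Set Circle1} (hq : P.q n ∈ J) :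
    (∏ i ∈ Finset.range n, P.kseq (i + 1)) * P.π 0 ≤
      {ℓ : ℕ | 1 ≤ ℓ ∧ ℓ ≤ P.π n ∧ S.wordComp (P.w n) ℓ (P.q n) ∈ P.Aset n J}.ncard := by
  obtain ⟨D, hcard, hD⟩ := P.exists_finset_wordComp_eq_multiComp n
  have hπ := P.π_pos n
  rw [← hcard, ← Set.ncard_coe_finset]
  refine Set.ncard_le_ncard_of_injOn (fun r => if r = 0 then P.π n else r) ?_ ?_
    ((Set.finite_Iic (P.π n)).subset fun r hr => hr.2.1)
  · intro r hr
    obtain ⟨hlt, ℓ, hℓ, t, ht, heq⟩ := hD r hr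
    have hmem : S.wordComp (P.w n) r (P.q n) ∈ P.Aset n J := by
      rw [heq]
      exact P.wordComp_multiComp_mem_Aset hq hℓ ht.le
    rcases eq_or_ne r 0 with rfl | h0
    · refine ⟨by simpa using Nat.succ_le_of_lt hπ, by simp, ?_⟩
      simpa [P.fixed n, SkewSetup.wordComp] using hmem
    · simpa [h0] using ⟨Nat.pos_of_ne_zero h0, hlt.le, hmem⟩
  · intro r hr r' hr' heq
    have hlt := (hD r hr).1
    have hlt' := (hD r' hr').1
    dsimp only at heq
    split_ifs at heq <;> omega

theorem prod_kseq_div_π_succ (n : ℕ) :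
    (∏ i ∈ Finset.range (n + 1), (P.kseq (i + 1) : ℝ)) * P.π 0 / P.π (n + 1) =
      (∏ i ∈ Finset.range n, (P.kseq (i + 1) : ℝ)) * P.π 0 / P.π n / (1 + P.lam (n + 1)) := by
  have hπ : (0 : ℝ) < P.π n := Nat.cast_pos.2 (P.π_pos n)
  have hk : (0 : ℝ) < P.kseq (n + 1) :=
    Nat.cast_pos.2 (Nat.zero_lt_two.trans_le (P.kseq_ge n))
  rw [lam, Nat.add_sub_cancel, P.period_eq, Finset.prod_range_succ]
  push_cast
  field_simp

theorem eq_prod_kseq_div_π {ρ : ℕ → ℝ} (h1 : ρ 1 = 1 / (1 + P.lam 1))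
    (hrec : ∀ n, 1 ≤ n → ρ (n + 1) = ρ n / (1 + P.lam (n + 1))) {n : ℕ} (hn : 1 ≤ n) :
    ρ n = (∏ i ∈ Finset.range n, (P.kseq (i + 1) : ℝ)) * P.π 0 / P.π n := by
  induction n, hn using Nat.le_induction with
  | base =>
    have hπ : (P.π 0 : ℝ) ≠ 0 := Nat.cast_ne_zero.2 (P.π_pos 0).ne'
    rw [P.prod_kseq_div_π_succ 0, h1]
    simp [hπ]
  | succ n hn ih => rw [hrec n hn, ih, P.prod_kseq_div_π_succ n]

end RepetitivePattern

/-- For a sequence of periodic orbits with repetitive pattern, with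
`ρ_1 = 1/(1+λ_1)` and `ρ_{n+1} = ρ_n/(1+λ_{n+1})`, the proportion of the orbit `X_n`
whose fiber coordinate belongs to `A_n` is at least `ρ_n`:
`#{ℓ ∈ {1,…,π_n} : f_{ω^n_ℓ}∘⋯∘f_{ω^n_1}(q_n) ∈ A_n} / π_n ≥ ρ_n`. -/
theorem orbit_proportion_in_strip_ge
    {k : ℕ} (S : SkewSetup k) (P : RepetitivePattern S)
    (J' : ℕ → Set Circle1)
    (hJ'arc : ∀ n, 1 ≤ n → ∃ c d : ℝ, c ≤ d ∧ J' n = projCircle '' Icc c d)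
    (hJ'q : ∀ n, 1 ≤ n → P.q n ∈ J' n)
    (hJ'sub : ∀ n, 1 ≤ n → J' n ⊆ projCircle '' Icc (P.a n) (P.b n))
    (hJ'sup : ∀ n, 1 ≤ n → projCircle '' Icc (P.a (n + 1)) (P.b (n + 1)) ⊆ J' n)
    (ρ : ℕ → ℝ)
    (hρ1 : ρ 1 = 1 / (1 + P.lam 1))
    (hρrec : ∀ n, 1 ≤ n → ρ (n + 1) = ρ n / (1 + P.lam (n + 1))) :
    ∀ n, 1 ≤ n →
      ρ n ≤ (({ℓ : ℕ | 1 ≤ ℓ ∧ ℓ ≤ P.π n ∧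
          S.wordComp (P.w n) ℓ (P.q n) ∈ P.Aset n (J' n)}.ncard : ℝ)) / (P.π n : ℝ) := by
  intro n hn
  rw [P.eq_prod_kseq_div_π hρ1 hρrec hn]
  gcongr
  exact_mod_cast P.le_ncard_orbit_mem_Aset n (hJ'q n hn)

end
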